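/- Low demand uncertainty case, worst-case distribution: Let h ∈ H₂, suppose r ≤ Δ_{s*,1}/(h'(1) − (1−β)), and let x* = μ − σ·(h^τ(s*) − 2(1−β))/(2Δ_{s*,1}) with h^τ(s*) ∈ [h'(s*), h'(s*+)]. Then the distribution F whose quantile function is F⁻¹(u) = μ − σ·(h'(1−u)/Δ_{s*,1})·1{u < 1−s*} + σ·(1−β)/Δ_{s*,1} belongs to S(μ,σ) and attains the inner supremum: ρ_h^F(ψ(x*,p,c)) = sup_{G ∈ S(μ,σ)} ρ_h^G(ψ(x*,p,c)). -/

import Mathlib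

open MeasureTheory Set

namespace NV

noncomputable section

/-- `hD h u`: the left derivative of `h` at `u` for `u ≠ 0`, and the right derivative at `0`. -/
def hD (h : ℝ → ℝ) (u : ℝ) : ℝ :=
  if u = 0 then derivWithin h (Set.Ioi (0 : ℝ)) 0 else derivWithin h (Set.Iio u) u

/-- A distortion function: nondecreasing on `[0,1]` with `h 0 = 0`, `h 1 = 1`. -/
def IsDistortion (h : ℝ → ℝ) : Prop :=
  MonotoneOn h (Set.Icc (0 : ℝ) 1) ∧ h 0 = 0 ∧ h 1 = 1

/-- Membership in `H₂`: a convex distortion function with square-integrable derivative. -/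
def MemH2 (h : ℝ → ℝ) : Prop :=
  IsDistortion h ∧ ConvexOn ℝ (Set.Icc (0 : ℝ) 1) h ∧
    IntegrableOn (fun u => (hD h u) ^ 2) (Set.Ioo (0 : ℝ) 1)

/-- Value-at-risk of `X` at level `α` under `P`. -/
def VaR {Ω : Type*} [MeasurableSpace Ω] (P : Measure Ω) (X : Ω → ℝ) (α : ℝ) : ℝ :=
  sInf {t : ℝ | α ≤ (P {ω | X ω ≤ t}).toReal}

/-- Distortion functional `ρ_h(X) = ∫₀¹ VaR_u(X) h'(u) du`. -/
def rho {Ω : Type*} [MeasurableSpace Ω] (h : ℝ → ℝ) (P : Measure Ω) (X : Ω → ℝ) : ℝ :=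
  ∫ u in Set.Ioo (0 : ℝ) 1, VaR P X u * hD h u

/-- Loss of ordering `x`: `ψ(x,p,c) = p·max{−S,−x} + c·x`, as a function of demand `s`. -/
def loss (p c x s : ℝ) : ℝ := p * max (-s) (-x) + c * x

/-- Distributions on `[0,∞)` with mean `μ` and second moment `μ² + σ²`. -/
def momentSet (μ σ : ℝ) : Set (Measure ℝ) :=
  {P | IsProbabilityMeasure P ∧ P (Set.Iio (0 : ℝ)) = 0 ∧
      (∫ s, s ∂P) = μ ∧ (∫ s, s ^ 2 ∂P) = μ ^ 2 + σ ^ 2}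

/-- Inner worst-case risk `sup_{F ∈ S(μ,σ)} ρ_h^F(ψ(x,p,c))` at order quantity `x`. -/
def wcInner (h : ℝ → ℝ) (p c μ σ x : ℝ) : ℝ :=
  sSup ((fun P => rho h P (loss p c x)) '' momentSet μ σ)

/-- Worst-case risk `ρ_h^wc(μ,σ) = inf_{x ≥ 0} sup_{F ∈ S(μ,σ)} ρ_h^F(ψ(x,p,c))`. -/
def wcRisk (h : ℝ → ℝ) (p c μ σ : ℝ) : ℝ :=
  sInf ((fun x => wcInner h p c μ σ x) '' Set.Ici (0 : ℝ))

/-- Generalized inverse `s* = h⁻¹(β)`. -/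
def sstar (h : ℝ → ℝ) (β : ℝ) : ℝ := sInf {u ∈ Set.Icc (0 : ℝ) 1 | β ≤ h u}

/-- `Δ_{s,t} = sqrt(t ∫_s^t h'(u)² du − (h(t) − β)²)`. -/
def Del (h : ℝ → ℝ) (β s t : ℝ) : ℝ :=
  Real.sqrt (t * (∫ u in Set.Ioc s t, (hD h u) ^ 2) - (h t - β) ^ 2)

/-- `σ_t = sqrt(t (μ² + σ²) − μ²)`. -/
def sigt (μ σ t : ℝ) : ℝ := Real.sqrt (t * (μ ^ 2 + σ ^ 2) - μ ^ 2)

/-- `h_s(u) = (h(u) − h(s))/(1 − h(s))` for `s < u ≤ 1`, and `0` otherwise. -/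
def hsub (h : ℝ → ℝ) (s u : ℝ) : ℝ :=
  if s < u ∧ u ≤ 1 then (h u - h s) / (1 - h s) else 0

/-- `k_{s,t}`. -/
def kst (h : ℝ → ℝ) (μ σ s t : ℝ) : ℝ :=
  sigt μ σ t /
    Real.sqrt (t * (∫ u in Set.Ioc (0 : ℝ) t, (hD (hsub h s) u) ^ 2) - (hsub h s t) ^ 2)

/-- `ℓ_{s,t}`. -/
def lst (h : ℝ → ℝ) (μ σ s t : ℝ) : ℝ :=
  -(μ / t) - kst h μ σ s t * hsub h s t / t

/-- The feasible region `D`. -/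
def Dset (h : ℝ → ℝ) (μ σ : ℝ) : Set (ℝ × ℝ) :=
  {q | 0 ≤ q.1 ∧ q.1 ≤ q.2 ∧ q.2 ≤ 1 ∧ μ ^ 2 / (μ ^ 2 + σ ^ 2) ≤ q.2 ∧
      kst h μ σ q.1 q.2 * hD (hsub h q.1) q.2 + lst h μ σ q.1 q.2 ≤ 0}

/-- `g_x(s,t)`. -/
def gfun (h : ℝ → ℝ) (μ σ x : ℝ) (q : ℝ × ℝ) : ℝ :=
  -(h q.1) * x - (μ / q.2) * (h q.2 - h q.1) +
    (sigt μ σ q.2 / q.2) *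
      Real.sqrt (q.2 * (∫ u in Set.Ioc q.1 q.2, (hD h u) ^ 2) - (h q.2 - h q.1) ^ 2)

/-- `t*`: the largest `t ∈ [1/(1+r²),1]` satisfying the defining inequality. -/
def tstar (h : ℝ → ℝ) (β r : ℝ) : ℝ :=
  sSup {t ∈ Set.Icc (1 / (1 + r ^ 2)) (1 : ℝ) |
    (1 + r ^ 2) * (t * hD h t - h t + β) ^ 2 -
      (∫ u in Set.Ioo (0 : ℝ) 1, (hD h u - h t + β) ^ 2) ≤ 0}

end

end NV

open NV MeasureTheory

namespace NV

theorem VaR_le_iff {Ω : Type*} [MeasurableSpace Ω] (P : Measure Ω) [IsProbabilityMeasure P]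
    {X : Ω → ℝ} (hX : Measurable X) {u : ℝ} (hu : u ∈ Set.Ioo (0 : ℝ) 1) (t : ℝ) :
    VaR P X u ≤ t ↔ u ≤ (P {ω | X ω ≤ t}).toReal := by
  have : IsProbabilityMeasure (P.map X) := Measure.isProbabilityMeasure_map hX.aemeasurable
  have hcdf : ∀ t, (P {ω | X ω ≤ t}).toReal = ProbabilityTheory.cdf (P.map X) t := fun t => by
    rw [ProbabilityTheory.cdf_eq_real, measureReal_def, Measure.map_apply hX measurableSet_Iic]
    rfl
  unfold VaR
  simp only [hcdf]
  set F := ProbabilityTheory.cdf (P.map X)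
  have hne : {t : ℝ | u ≤ F t}.Nonempty :=
    (((ProbabilityTheory.tendsto_cdf_atTop (P.map X)).eventually
      (lt_mem_nhds hu.2)).mono fun _ ht => ht.le).exists
  have hbdd : BddBelow {t : ℝ | u ≤ F t} := by
    obtain ⟨b, hb⟩ := ((ProbabilityTheory.tendsto_cdf_atBot (P.map X)).eventually
      (gt_mem_nhds hu.1)).exists
    refine ⟨b, fun t ht => ?_⟩
    by_contra! hlt
    exact (hb.trans_le ht).not_ge (F.mono hlt.le)
  refine ⟨fun hle => ?_, fun hut => csInf_le hbdd hut⟩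
  have hright : Filter.Tendsto F (nhdsWithin t (Set.Ioi t)) (nhds (F t)) :=
    (F.right_continuous t).tendsto.mono_left (nhdsWithin_mono _ Set.Ioi_subset_Ici_self)
  refine ge_of_tendsto hright (Filter.eventually_of_mem self_mem_nhdsWithin fun y hy => ?_)
  obtain ⟨z, hz, hzy⟩ := exists_lt_of_csInf_lt hne (hle.trans_lt hy)
  exact le_trans hz (F.mono hzy.le)

theorem monotoneOn_VaR {Ω : Type*} [MeasurableSpace Ω] (P : Measure Ω) [IsProbabilityMeasure P]
    {X : Ω → ℝ} (hX : Measurable X) : MonotoneOn (VaR P X) (Set.Ioo (0 : ℝ) 1) :=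
  fun _ hu _ hv huv =>
    (VaR_le_iff P hX hu _).2 (huv.trans ((VaR_le_iff P hX hv _).1 le_rfl))

theorem aemeasurable_VaR {Ω : Type*} [MeasurableSpace Ω] (P : Measure Ω)
    [IsProbabilityMeasure P] {X : Ω → ℝ} (hX : Measurable X) :
    AEMeasurable (VaR P X) (volume.restrict (Set.Ioo (0 : ℝ) 1)) :=
  aemeasurable_restrict_of_monotoneOn measurableSet_Ioo (monotoneOn_VaR P hX)

instance : IsProbabilityMeasure (volume.restrict (Set.Ioo (0 : ℝ) 1)) :=
  ⟨by simp⟩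

theorem map_VaR {Ω : Type*} [MeasurableSpace Ω] (P : Measure Ω) [IsProbabilityMeasure P]
    {X : Ω → ℝ} (hX : Measurable X) :
    Measure.map (VaR P X) (volume.restrict (Set.Ioo (0 : ℝ) 1)) = P.map X := by
  have : IsProbabilityMeasure (P.map X) := Measure.isProbabilityMeasure_map hX.aemeasurable
  have hm := aemeasurable_VaR P hX
  have : IsProbabilityMeasure (Measure.map (VaR P X) (volume.restrict (Set.Ioo (0 : ℝ) 1))) :=
    Measure.isProbabilityMeasure_map hm
  refine Measure.ext_of_Iic _ _ fun t => ?_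
  rw [Measure.map_apply_of_aemeasurable hm measurableSet_Iic,
    Measure.map_apply hX measurableSet_Iic, Measure.restrict_apply' measurableSet_Ioo]
  have hPt : P (X ⁻¹' Set.Iic t) = ENNReal.ofReal (P {ω | X ω ≤ t}).toReal :=
    (ENNReal.ofReal_toReal (measure_ne_top _ _)).symm
  set q := (P {ω | X ω ≤ t}).toReal
  have hq1 : q ≤ 1 := measureReal_le_one
  have hset : VaR P X ⁻¹' Set.Iic t ∩ Set.Ioo 0 1 = Set.Iic q ∩ Set.Ioo 0 1 := by
    ext u
    simp only [Set.mem_inter_iff, Set.mem_preimage, Set.mem_Iic]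
    exact and_congr_left fun hu => VaR_le_iff P hX hu t
  rw [hset, hPt]
  apply le_antisymm
  · refine (measure_mono (t := Set.Ioc 0 q) fun u hu => ⟨hu.2.1, hu.1⟩).trans ?_
    simp
  · refine le_trans ?_ (measure_mono (s := Set.Ioo 0 q) fun u hu =>
      ⟨hu.2.le, hu.1, hu.2.trans_le hq1⟩)
    simp

theorem VaR_loss (P : Measure ℝ) [IsProbabilityMeasure P] {p : ℝ} (hp : 0 < p) (c x : ℝ)
    {u : ℝ} (hu : u ∈ Set.Ioo (0 : ℝ) 1) :
    VaR P (loss p c x) u = p * max (VaR P (fun s => -s) u) (-x) + c * x := by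
  have key : {t : ℝ | u ≤ (P {s | loss p c x s ≤ t}).toReal} =
      Set.Ici (p * max (VaR P (fun s => -s) u) (-x) + c * x) := by
    ext t
    have hiff : ∀ y : ℝ, p * max y (-x) + c * x ≤ t ↔ y ≤ (t - c * x) / p ∧ -x ≤ (t - c * x) / p :=
      fun y => by rw [← max_le_iff, le_div_iff₀ hp, ← le_sub_iff_add_le, mul_comm]
    simp only [Set.mem_ofPred_eq, Set.mem_Ici, loss, hiff]
    by_cases hx : -x ≤ (t - c * x) / p
    · simp only [hx, and_true]
      exact (VaR_le_iff P measurable_neg hu _).symm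
    · simp only [hx, and_false, iff_false]
      simpa using hu.1
  unfold VaR at key ⊢
  rw [key, csInf_Ici]

theorem VaR_ae_eq_of_monotoneOn {Ω : Type*} [MeasurableSpace Ω] (P : Measure Ω)
    [IsProbabilityMeasure P] {X : Ω → ℝ} (hX : Measurable X) {Q : ℝ → ℝ}
    (hQ : MonotoneOn Q (Set.Ioo (0 : ℝ) 1))
    (hint : Integrable Q (volume.restrict (Set.Ioo (0 : ℝ) 1)))
    (hmap : P.map X = Measure.map Q (volume.restrict (Set.Ioo (0 : ℝ) 1))) :
    VaR P X =ᵐ[volume.restrict (Set.Ioo (0 : ℝ) 1)] Q := by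
  have hQm : AEMeasurable Q (volume.restrict (Set.Ioo (0 : ℝ) 1)) :=
    aemeasurable_restrict_of_monotoneOn measurableSet_Ioo hQ
  have hVm := aemeasurable_VaR P hX
  have hV := map_VaR P hX
  have hle : VaR P X ≤ᵐ[volume.restrict (Set.Ioo (0 : ℝ) 1)] Q := by
    filter_upwards [ae_restrict_mem measurableSet_Ioo] with u hu
    rw [VaR_le_iff P hX hu]
    have h1 : P {ω | X ω ≤ Q u} = P.map X (Set.Iic (Q u)) :=
      (Measure.map_apply hX measurableSet_Iic).symm
    rw [h1, hmap, Measure.map_apply_of_aemeasurable hQm measurableSet_Iic,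
      Measure.restrict_apply' measurableSet_Ioo, ← ENNReal.ofReal_le_iff_le_toReal]
    · refine le_trans ?_ (measure_mono (s := Set.Ioo 0 u) fun v hv => ?_)
      · simp
      · have hv' : v ∈ Set.Ioo (0 : ℝ) 1 := ⟨hv.1, hv.2.trans hu.2⟩
        exact ⟨hQ hv' hu hv.2.le, hv'⟩
    · exact ((measure_mono Set.inter_subset_right).trans_lt (by simp)).ne
  have hid : Integrable (fun y : ℝ => y) (Measure.map Q (volume.restrict (Set.Ioo (0 : ℝ) 1))) :=
    (integrable_map_measure aestronglyMeasurable_id hQm).2 hint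
  have hVint : Integrable (VaR P X) (volume.restrict (Set.Ioo (0 : ℝ) 1)) := by
    rw [← hmap, ← hV] at hid
    exact (integrable_map_measure aestronglyMeasurable_id hVm).1 hid
  refine (integral_eq_iff_of_ae_le hVint hint hle).1 ?_
  have e1 := integral_map (f := fun y : ℝ => y) hVm aestronglyMeasurable_id
  have e2 := integral_map (f := fun y : ℝ => y) hQm aestronglyMeasurable_id
  rw [← e1, ← e2, hV, hmap]

theorem rho_loss (h : ℝ → ℝ) (P : Measure ℝ) [IsProbabilityMeasure P] {p : ℝ} (hp : 0 < p)
    (c x : ℝ) :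
    rho h P (loss p c x) =
      ∫ u in Set.Ioo (0 : ℝ) 1, (p * max (VaR P (fun s => -s) u) (-x) + c * x) * hD h u :=
  setIntegral_congr_fun measurableSet_Ioo fun u hu => by
    simp only [VaR_loss P hp c x hu]

theorem hD_of_ne_zero (h : ℝ → ℝ) {u : ℝ} (hu : u ≠ 0) :
    hD h u = derivWithin h (Set.Iio u) u := if_neg hu

section Convex

variable {h : ℝ → ℝ}

theorem hD_le_rightDeriv (hconv : ConvexOn ℝ (Set.Icc (0 : ℝ) 1) h) {u : ℝ}
    (hu : u ∈ Set.Ioo (0 : ℝ) 1) : hD h u ≤ derivWithin h (Set.Ioi u) u := by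
  rw [hD_of_ne_zero h hu.1.ne']
  exact hconv.leftDeriv_le_rightDeriv_of_mem_interior (by rwa [interior_Icc])

theorem rightDeriv_le_hD (hconv : ConvexOn ℝ (Set.Icc (0 : ℝ) 1) h)
    (hd : DifferentiableWithinAt ℝ h (Set.Iio 1) 1) {u v : ℝ} (hu : u ∈ Set.Ioo (0 : ℝ) 1)
    (huv : u < v) (hv : v ≤ 1) : derivWithin h (Set.Ioi u) u ≤ hD h v := by
  have hv0 : 0 < v := hu.1.trans huv
  rw [hD_of_ne_zero h hv0.ne']
  refine (hconv.rightDeriv_le_slope_of_mem_interior (by rwa [interior_Icc])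
    ⟨hv0.le, hv⟩ huv).trans (hconv.slope_le_leftDeriv ⟨hu.1.le, hu.2.le⟩ ⟨hv0.le, hv⟩ huv ?_)
  rcases hv.eq_or_lt with rfl | hv1
  · exact hd
  · exact hconv.differentiableWithinAt_Iio_of_mem_interior (by rw [interior_Icc]; exact ⟨hv0, hv1⟩)

theorem monotoneOn_hD (hconv : ConvexOn ℝ (Set.Icc (0 : ℝ) 1) h)
    (hd : DifferentiableWithinAt ℝ h (Set.Iio 1) 1) : MonotoneOn (hD h) (Set.Ioc 0 1) := by
  intro u hu v hv huv
  rcases huv.eq_or_lt with rfl | hlt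
  · rfl
  · have hu' : u ∈ Set.Ioo (0 : ℝ) 1 := ⟨hu.1, hlt.trans_le hv.2⟩
    exact (hD_le_rightDeriv hconv hu').trans (rightDeriv_le_hD hconv hd hu' hlt hv.2)

theorem IsDistortion.le_self (hdist : IsDistortion h) (hconv : ConvexOn ℝ (Set.Icc (0 : ℝ) 1) h)
    {u : ℝ} (hu : u ∈ Set.Icc (0 : ℝ) 1) : h u ≤ u := by
  have := hconv.2 (x := 0) (y := 1) (by simp) (by simp) (sub_nonneg.2 hu.2) hu.1 (by ring)
  simpa [hdist.2.1, hdist.2.2] using this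

theorem IsDistortion.nonneg (hdist : IsDistortion h) {u : ℝ} (hu : u ∈ Set.Icc (0 : ℝ) 1) :
    0 ≤ h u := by
  have := hdist.1 (by simp) hu hu.1
  rwa [hdist.2.1] at this

theorem IsDistortion.hD_nonneg (hdist : IsDistortion h)
    (hconv : ConvexOn ℝ (Set.Icc (0 : ℝ) 1) h) {u : ℝ} (hu : u ∈ Set.Ioo (0 : ℝ) 1) :
    0 ≤ hD h u := by
  rw [hD_of_ne_zero h hu.1.ne']
  have hu' : u ∈ Set.Icc (0 : ℝ) 1 := ⟨hu.1.le, hu.2.le⟩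
  refine le_trans ?_ (hconv.slope_le_leftDeriv_of_mem_interior (x := 0) (by simp)
    (by rwa [interior_Icc]) hu.1)
  rw [slope_def_field, hdist.2.1]
  exact div_nonneg (by simpa using hdist.nonneg hu') (by simpa using hu.1.le)

theorem IsDistortion.continuousOn (hdist : IsDistortion h)
    (hconv : ConvexOn ℝ (Set.Icc (0 : ℝ) 1) h)
    (hd : DifferentiableWithinAt ℝ h (Set.Iio 1) 1) : ContinuousOn h (Set.Icc 0 1) := by
  intro u hu
  rcases hu.1.eq_or_lt with rfl | hu0
  · rw [ContinuousWithinAt, hdist.2.1]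
    refine squeeze_zero' (g := fun u => u) ?_ ?_ ?_
    · exact Filter.eventually_of_mem self_mem_nhdsWithin fun v hv => hdist.nonneg hv
    · exact Filter.eventually_of_mem self_mem_nhdsWithin fun v hv => hdist.le_self hconv hv
    · exact Filter.tendsto_id.mono_left nhdsWithin_le_nhds
  rcases hu.2.eq_or_lt with rfl | hu1
  · exact (continuousWithinAt_Iio_iff_Iic.1 hd.continuousWithinAt).mono Set.Icc_subset_Iic_self
  · have hmem : u ∈ interior (Set.Icc (0 : ℝ) 1) := by rw [interior_Icc]; exact ⟨hu0, hu1⟩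
    exact ((hconv.continuousOn_interior u hmem).continuousAt
      (isOpen_interior.mem_nhds hmem)).continuousWithinAt

theorem sstar_mem_Ioo_and_apply_sstar (hdist : IsDistortion h)
    (hcont : ContinuousOn h (Set.Icc 0 1)) {β : ℝ} (hβ : β ∈ Set.Ioo (0 : ℝ) 1) :
    sstar h β ∈ Set.Ioo (0 : ℝ) 1 ∧ h (sstar h β) = β := by
  obtain ⟨u, hu, hhu⟩ : ∃ u ∈ Set.Icc (0 : ℝ) 1, h u = β := by
    refine intermediate_value_Icc zero_le_one hcont ?_
    rw [hdist.2.1, hdist.2.2]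
    exact ⟨hβ.1.le, hβ.2.le⟩
  set S := {u ∈ Set.Icc (0 : ℝ) 1 | β ≤ h u}
  have hclosed : IsClosed S := hcont.preimage_isClosed_of_isClosed isClosed_Icc isClosed_Ici
  have hbdd : BddBelow S := ⟨0, fun v hv => hv.1.1⟩
  have huS : u ∈ S := ⟨hu, hhu.ge⟩
  have hmem : sstar h β ∈ S := hclosed.csInf_mem ⟨u, huS⟩ hbdd
  have heq : h (sstar h β) = β :=
    le_antisymm ((hdist.1 hmem.1 hu (csInf_le hbdd huS)).trans_eq hhu) hmem.2
  refine ⟨⟨hmem.1.1.lt_of_ne fun h0 => ?_, hmem.1.2.lt_of_ne fun h1 => ?_⟩, heq⟩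
  · rw [← h0, hdist.2.1] at heq
    exact hβ.1.ne heq
  · rw [h1, hdist.2.2] at heq
    exact hβ.2.ne' heq

theorem setIntegral_hD (hconv : ConvexOn ℝ (Set.Icc (0 : ℝ) 1) h)
    (hd : DifferentiableWithinAt ℝ h (Set.Iio 1) 1) (hcont : ContinuousOn h (Set.Icc 0 1))
    {s : ℝ} (hs : s ∈ Set.Ioo (0 : ℝ) 1) : ∫ u in Set.Ioc s 1, hD h u = h 1 - h s := by
  have hmono : MonotoneOn (hD h) (Set.uIcc s 1) := by
    rw [Set.uIcc_of_le hs.2.le]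
    exact (monotoneOn_hD hconv hd).mono fun v hv => ⟨hs.1.trans_le hv.1, hv.2⟩
  have hii : IntervalIntegrable (hD h) volume s 1 := hmono.intervalIntegrable
  rw [← intervalIntegral.integral_of_le hs.2.le]
  have key := intervalIntegral.integral_eq_sub_of_hasDeriv_right_of_le
    (a := -1) (b := -s) (f := fun t => -h (-t)) (f' := fun t => hD h (-t)) (by linarith [hs.2])
    ?_ ?_ ?_
  · rw [intervalIntegral.integral_comp_neg (fun t => hD h t)] at key
    simp only [neg_neg] at key
    linarith
  · refine (hcont.comp continuousOn_neg fun t ht => ?_).neg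
    exact ⟨by linarith [hs.1, ht.2], by linarith [ht.1]⟩
  · intro t ht
    have hmem : -t ∈ Set.Ioo (0 : ℝ) 1 := ⟨by linarith [hs.1, ht.2], by linarith [ht.1]⟩
    have h1 := hconv.hasDerivWithinAt_leftDeriv_of_mem_interior (x := -t) (by rwa [interior_Icc])
    rw [← hD_of_ne_zero h hmem.1.ne'] at h1
    have h2 : HasDerivWithinAt (fun t => -h (-t)) (-(hD h (-t) * -1)) (Set.Ioi t) t :=
      (h1.comp t (h := fun t => -t) (hasDerivAt_neg t).hasDerivWithinAt
        fun y hy => by simpa using hy).neg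
    rwa [mul_neg_one, neg_neg] at h2
  · have h3 := hii.symm.comp_sub_left 0
    simpa using h3

end Convex

theorem max_mul_le_add_sq_sub_sq {k w x τ A f : ℝ} (hk : 0 < k) (hw : 0 ≤ w) (hx : x = A - k * τ / 2)
    (hf : (f = A ∧ w ≤ τ) ∨ (f = A - k * w ∧ τ ≤ w)) (v : ℝ) :
    max v (-x) * w ≤
      max (-f) (-x) * w + (1 / (2 * k)) * ((v + A) ^ 2 - (-f + A) ^ 2) := by
  have h0 : 0 ≤ (1 / (2 * k)) * (v + A) ^ 2 := by positivity
  have h1 : 0 ≤ (1 / (2 * k)) * (v + A - k * w) ^ 2 := by positivity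
  have e1 : (1 / (2 * k)) * (v + A - k * w) ^ 2 =
    (1 / (2 * k)) * (v + A) ^ 2 - (v + A) * w + k * w ^ 2 / 2 := by field_simp; ring
  rcases hf with ⟨rfl, hwτ⟩ | ⟨rfl, hτw⟩
  · have h2 : 0 ≤ k * (τ - w) * w := mul_nonneg (mul_nonneg hk.le (sub_nonneg.2 hwτ)) hw
    have h3 : -x * w ≤ max (-f) (-x) * w := mul_le_mul_of_nonneg_right (le_max_right _ _) hw
    rcases max_choice v (-x) with hm | hm <;> rw [hm] <;> subst hx <;> nlinarith
  · have h2 : 0 ≤ k * (w - τ) * w := mul_nonneg (mul_nonneg hk.le (sub_nonneg.2 hτw)) hw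
    have h3 : -(A - k * w) * w ≤ max (-(A - k * w)) (-x) * w :=
      mul_le_mul_of_nonneg_right (le_max_left _ _) hw
    have e2 : (1 / (2 * k)) * (-(A - k * w) + A) ^ 2 = k * w ^ 2 / 2 := by field_simp; ring
    rcases max_choice v (-x) with hm | hm <;> rw [hm] <;> subst hx <;> nlinarith

theorem integrable_of_mem_momentSet {μ σ : ℝ} (hμ : 0 < μ) {G : Measure ℝ}
    (hG : G ∈ momentSet μ σ) : Integrable (fun s : ℝ => s) G ∧ Integrable (fun s : ℝ => s ^ 2) G := by
  obtain ⟨-, -, h1, h2⟩ := hG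
  constructor
  · by_contra hn
    rw [integral_undef hn] at h1
    exact hμ.ne h1
  · by_contra hn
    rw [integral_undef hn] at h2
    have : 0 < μ ^ 2 + σ ^ 2 := by positivity
    exact this.ne h2

theorem moments_of_map_eq_map_neg {Ω : Type*} [MeasurableSpace Ω] {P : Measure Ω} {μ σ : ℝ}
    (hμ : 0 < μ) {G : Measure ℝ} (hG : G ∈ momentSet μ σ) {Q : Ω → ℝ} (hQ : AEMeasurable Q P)
    (hmap : P.map Q = G.map (fun s => -s)) (A : ℝ) :
    Integrable Q P ∧ Integrable (fun u => (Q u + A) ^ 2) P ∧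
      ∫ u, (Q u + A) ^ 2 ∂P = σ ^ 2 + (μ - A) ^ 2 := by
  obtain ⟨i1, i2⟩ := integrable_of_mem_momentSet hμ hG
  obtain ⟨hprob, -, m1, m2⟩ := hG
  have hexp : ∀ s : ℝ, (-s + A) ^ 2 = s ^ 2 - 2 * A * s + A ^ 2 := fun s => by ring
  have hsm : AEStronglyMeasurable (fun y : ℝ => (y + A) ^ 2) (P.map Q) := by fun_prop
  have hsm' : AEStronglyMeasurable (fun y : ℝ => (y + A) ^ 2) (G.map (fun s => -s)) := by fun_prop
  have i3 : Integrable (fun s : ℝ => s ^ 2 - 2 * A * s) G := i2.sub (i1.const_mul _)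
  refine ⟨?_, ?_, ?_⟩
  · refine (integrable_map_measure (g := fun y : ℝ => y) aestronglyMeasurable_id hQ).1 ?_
    rw [hmap]
    exact (integrable_map_measure aestronglyMeasurable_id measurable_neg.aemeasurable).2 i1.neg
  · refine (integrable_map_measure hsm hQ).1 ?_
    rw [hmap]
    refine (integrable_map_measure hsm' measurable_neg.aemeasurable).2 ?_
    simp only [Function.comp_def, hexp]
    exact i3.add (integrable_const _)
  · rw [← integral_map (f := fun y : ℝ => (y + A) ^ 2) hQ hsm, hmap,
      integral_map measurable_neg.aemeasurable hsm']
    simp only [hexp]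
    rw [integral_add i3 (integrable_const _), integral_sub i2 (i1.const_mul _),
      integral_const_mul, m1, m2]
    simp
    ring

theorem map_one_sub_Ioo :
    Measure.map (fun u : ℝ => 1 - u) (volume.restrict (Set.Ioo (0 : ℝ) 1)) =
      volume.restrict (Set.Ioo (0 : ℝ) 1) := by
  have := (Measure.measurePreserving_sub_left (volume : Measure ℝ) 1).restrict_preimage
    (s := Set.Ioo (0 : ℝ) 1) measurableSet_Ioo
  simpa using this.map_eq

end NV

/-- Low demand uncertainty case: the worst-case distribution. -/
theorem stmt3 (p c μ σ : ℝ) (hc : 0 < c) (hcp : c < p) (hμ : 0 < μ) (hσ : 0 < σ)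
    (h : ℝ → ℝ) (hH2 : MemH2 h)
    (sst Δ : ℝ) (hsst : sst = sstar h (c / p)) (hΔ : Δ = Del h (c / p) sst 1)
    (hr : σ / μ ≤ Δ / (hD h 1 - (1 - c / p)))
    (htau : ℝ) (htmem : htau ∈ Set.Icc (hD h sst) (derivWithin h (Set.Ioi sst) sst))
    (xs : ℝ) (hxs : xs = μ - σ * (htau - 2 * (1 - c / p)) / (2 * Δ)) :
    ∀ P : Measure ℝ,
      P = Measure.map
            (fun u : ℝ =>
              μ - σ * (hD h (1 - u) / Δ) * (if u < 1 - sst then 1 else 0)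
                + σ * (1 - c / p) / Δ)
            (volume.restrict (Set.Ioo (0 : ℝ) 1)) →
        P ∈ momentSet μ σ ∧ rho h P (loss p c xs) = wcInner h p c μ σ xs := by
  obtain ⟨hdist, hconv, -⟩ := hH2
  have hp : 0 < p := hc.trans hcp
  have hβ : c / p ∈ Set.Ioo (0 : ℝ) 1 := ⟨div_pos hc hp, (div_lt_one hp).2 hcp⟩
  set a := 1 - c / p with ha
  have ha0 : 0 < a := sub_pos.2 hβ.2
  have hΔ0 : 0 ≤ Δ := hΔ ▸ Real.sqrt_nonneg _
  have hrpos : 0 < Δ / (hD h 1 - a) := (div_pos hσ hμ).trans_le hr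
  have hMa : 0 < hD h 1 - a := by
    by_contra! hle
    exact hrpos.not_ge (div_nonpos_of_nonneg_of_nonpos hΔ0 hle)
  have hΔpos : 0 < Δ := by
    rcases hΔ0.eq_or_lt with h0 | h0
    · simp [← h0] at hrpos
    · exact h0
  have hd : DifferentiableWithinAt ℝ h (Set.Iio 1) 1 := by
    by_contra hn
    have := derivWithin_zero_of_not_differentiableWithinAt hn
    rw [hD_of_ne_zero h one_ne_zero, this] at hMa
    linarith
  have hcont := hdist.continuousOn hconv hd
  obtain ⟨hs, hhs⟩ := sstar_mem_Ioo_and_apply_sstar hdist hcont hβ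
  rw [← hsst] at hs hhs
  have hmono := monotoneOn_hD hconv hd
  have hw0 : ∀ u ∈ Set.Ioo (0 : ℝ) 1, 0 ≤ hD h u := fun u hu => hdist.hD_nonneg hconv hu
  have hwM : ∀ u ∈ Set.Ioo (0 : ℝ) 1, hD h u ≤ hD h 1 := fun u hu =>
    hmono ⟨hu.1, hu.2.le⟩ ⟨one_pos, le_rfl⟩ hu.2.le
  have hint_w : ∫ u in Set.Ioc sst 1, hD h u = a := by
    rw [setIntegral_hD hconv hd hcont hs, hdist.2.2, hhs]
  have hint_w2 : ∫ u in Set.Ioc sst 1, hD h u ^ 2 = Δ ^ 2 + a ^ 2 := by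
    have hpos : 0 < 1 * (∫ u in Set.Ioc sst 1, hD h u ^ 2) - (h 1 - c / p) ^ 2 :=
      by
      rw [hΔ, Del] at hΔpos
      exact Real.sqrt_pos.1 hΔpos
    have := Real.sq_sqrt hpos.le
    rw [← Del, ← hΔ, hdist.2.2] at this
    linarith
  set k := σ / Δ with hk
  have hk0 : 0 < k := div_pos hσ hΔpos
  have hkΔ : k * Δ = σ := div_mul_cancel₀ _ hΔpos.ne'
  set A := μ + k * a with hA
  set lam : Measure ℝ := volume.restrict (Set.Ioo (0 : ℝ) 1) with hlam
  -- the candidate, with the order of quantiles reversed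
  set f : ℝ → ℝ := fun u => A - k * (Set.Ioi sst).indicator (hD h) u with hf
  have hf_le : ∀ u, u ≤ sst → f u = A := fun u hu => by
    simp [hf, Set.indicator_of_notMem (show u ∉ Set.Ioi sst from not_lt.2 hu)]
  have hf_gt : ∀ u, sst < u → f u = A - k * hD h u := fun u hu => by
    simp [hf, Set.indicator_of_mem (show u ∈ Set.Ioi sst from hu)]
  have hx : xs = A - k * htau / 2 := by
    rw [hxs, hA, hk]; field_simp; ring
  have hopt : ∀ u ∈ Set.Ioo (0 : ℝ) 1,
      (f u = A ∧ hD h u ≤ htau) ∨ (f u = A - k * hD h u ∧ htau ≤ hD h u) := by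
    intro u hu
    rcases le_or_gt u sst with hus | hus
    · exact Or.inl ⟨hf_le u hus,
        (hmono ⟨hu.1, hu.2.le⟩ ⟨hs.1, hs.2.le⟩ hus).trans htmem.1⟩
    · exact Or.inr ⟨hf_gt u hus, htmem.2.trans (rightDeriv_le_hD hconv hd hs hus hu.2.le)⟩
  have hf_nonneg : ∀ u ∈ Set.Ioo (0 : ℝ) 1, 0 ≤ f u := by
    intro u hu
    have hkM : k * (hD h 1 - a) ≤ μ := by
      rw [div_le_div_iff₀ hμ hMa] at hr
      rw [hk, div_mul_eq_mul_div, div_le_iff₀ hΔpos]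
      linarith
    rcases le_or_gt u sst with hus | hus
    · rw [hf_le u hus]; positivity
    · rw [hf_gt u hus]
      nlinarith [mul_le_mul_of_nonneg_left (hwM u hu) hk0.le]
  have hf_le_A : ∀ u ∈ Set.Ioo (0 : ℝ) 1, f u ≤ A := by
    intro u hu
    rcases le_or_gt u sst with hus | hus
    · exact (hf_le u hus).le
    · rw [hf_gt u hus]
      nlinarith [mul_nonneg hk0.le (hw0 u hu)]
  have hwm : AEMeasurable (hD h) lam := aemeasurable_restrict_of_monotoneOn measurableSet_Ioo
    (hmono.mono Set.Ioo_subset_Ioc_self)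
  have hfm : AEMeasurable f lam := ((hwm.indicator measurableSet_Ioi).const_mul k).const_sub A
  have hfanti : MonotoneOn (fun u => -f u) (Set.Ioo (0 : ℝ) 1) := by
    intro u hu v hv huv
    rcases le_or_gt u sst with hus | hus
    · simpa only [neg_le_neg_iff, hf_le u hus] using hf_le_A v hv
    · have := mul_le_mul_of_nonneg_left (hmono ⟨hu.1, hu.2.le⟩ ⟨hv.1, hv.2.le⟩ huv) hk0.le
      simp only [hf_gt u hus, hf_gt v (hus.trans_le huv)]
      linarith
  have hwi : Integrable (hD h) lam := Integrable.of_bound hwm.aestronglyMeasurable (hD h 1) (by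
    filter_upwards [ae_restrict_mem measurableSet_Ioo] with u hu
    rw [Real.norm_of_nonneg (hw0 u hu)]
    exact hwM u hu)
  have hw2i : Integrable (fun u => hD h u ^ 2) lam :=
    Integrable.of_bound (hwm.pow_const 2).aestronglyMeasurable (hD h 1 ^ 2) (by
      filter_upwards [ae_restrict_mem measurableSet_Ioo] with u hu
      rw [Real.norm_of_nonneg (sq_nonneg _)]
      exact pow_le_pow_left₀ (hw0 u hu) (hwM u hu) 2)
  have hind : ∀ g : ℝ → ℝ, ∫ u, (Set.Ioi sst).indicator g u ∂lam = ∫ u in Set.Ioc sst 1, g u := by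
    intro g
    rw [integral_indicator measurableSet_Ioi, hlam, Measure.restrict_restrict measurableSet_Ioi,
      integral_Ioc_eq_integral_Ioo]
    congr 2
    ext u
    simp only [Set.mem_inter_iff, Set.mem_Ioi, Set.mem_Ioo]
    exact ⟨fun hu => ⟨hu.1, hu.2.2⟩, fun hu => ⟨hu.1, hs.1.trans hu.1, hu.2⟩⟩
  have hint_f : ∫ u, f u ∂lam = μ := by
    rw [hf, integral_sub (integrable_const _) ((hwi.indicator measurableSet_Ioi).const_mul k),
      integral_const_mul, hind, hint_w]
    simp [hA]
  have hint_f2 : ∫ u, f u ^ 2 ∂lam = μ ^ 2 + σ ^ 2 := by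
    have hexp : ∀ u, f u ^ 2 = A ^ 2 - (2 * A * k) * (Set.Ioi sst).indicator (hD h) u +
        k ^ 2 * (Set.Ioi sst).indicator (fun u => hD h u ^ 2) u := by
      intro u
      by_cases hu : u ∈ Set.Ioi sst
      · simp only [hf, Set.indicator_of_mem hu]; ring
      · simp only [hf, Set.indicator_of_notMem hu]; ring
    have i1 := (hwi.indicator (measurableSet_Ioi (a := sst))).const_mul (2 * A * k)
    have i2 := (hw2i.indicator (measurableSet_Ioi (a := sst))).const_mul (k ^ 2)
    have i0 : Integrable (fun u => A ^ 2 - 2 * A * k * (Set.Ioi sst).indicator (hD h) u) lam :=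
      (integrable_const _).sub i1
    simp only [hexp]
    rw [integral_add i0 i2, integral_sub (integrable_const _) i1,
      integral_const_mul, integral_const_mul, hind, hind, hint_w, hint_w2, ← hkΔ]
    simp [hA]
    ring
  intro P hP
  have hPf : P = lam.map f := by
    have hcomp : lam.map (f ∘ fun u => 1 - u) = lam.map f := by
      have hfm' := hfm
      rw [hlam, ← map_one_sub_Ioo] at hfm'
      rw [← AEMeasurable.map_map_of_aemeasurable hfm' (by fun_prop), map_one_sub_Ioo]
    rw [hP, ← hcomp]
    congr 1
    ext u
    by_cases hu : u < 1 - sst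
    · rw [Function.comp_apply, hf_gt _ (by linarith), if_pos hu, hA, hk]; ring
    · rw [Function.comp_apply, hf_le _ (by linarith), if_neg hu, hA, hk]; ring
  have hPprob : IsProbabilityMeasure P := hPf ▸ Measure.isProbabilityMeasure_map hfm
  have hPmem : P ∈ momentSet μ σ := by
    refine ⟨hPprob, ?_, ?_, ?_⟩
    · rw [hPf, Measure.map_apply_of_aemeasurable hfm measurableSet_Iio,
        Measure.restrict_apply' measurableSet_Ioo]
      convert measure_empty (μ := (volume : Measure ℝ))
      exact Set.eq_empty_of_forall_notMem fun u hu => (hf_nonneg u hu.2).not_gt hu.1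
    · rw [hPf, integral_map (f := fun y : ℝ => y) hfm aestronglyMeasurable_id, ← hint_f]
    · rw [hPf, integral_map hfm (by fun_prop), ← hint_f2]
  have hPneg : lam.map (fun u => -f u) = P.map (fun s => -s) := by
    rw [hPf, AEMeasurable.map_map_of_aemeasurable measurable_neg.aemeasurable hfm]
    rfl
  have hPmom := moments_of_map_eq_map_neg hμ hPmem (Q := fun u => -f u) hfm.neg hPneg A
  have hint_loss : ∀ v : ℝ → ℝ, Integrable v lam →
      Integrable (fun u => (p * max (v u) (-xs) + c * xs) * hD h u) lam := by
    intro v hv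
    refine Integrable.mul_bdd (c := hD h 1)
      (((hv.sup (integrable_const (-xs))).const_mul p).add (integrable_const _))
      hwm.aestronglyMeasurable ?_
    filter_upwards [ae_restrict_mem measurableSet_Ioo] with u hu
    rw [Real.norm_of_nonneg (hw0 u hu)]
    exact hwM u hu
  have hrhoP : rho h P (loss p c xs) =
      ∫ u in Set.Ioo (0 : ℝ) 1, (p * max (-f u) (-xs) + c * xs) * hD h u := by
    rw [rho_loss h P hp]
    refine integral_congr_ae ?_
    filter_upwards [VaR_ae_eq_of_monotoneOn P measurable_neg hfanti hPmom.1 hPneg.symm] with u hu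
    rw [hu]
  suffices hgr : IsGreatest ((fun P => rho h P (loss p c xs)) '' momentSet μ σ)
      (rho h P (loss p c xs)) from ⟨hPmem, hgr.csSup_eq.symm⟩
  refine ⟨⟨P, hPmem, rfl⟩, ?_⟩
  rintro _ ⟨G, hG, rfl⟩
  have hGprob : IsProbabilityMeasure G := hG.1
  have hGmom := moments_of_map_eq_map_neg hμ hG (aemeasurable_VaR G measurable_neg)
    (map_VaR G measurable_neg) A
  simp only [hrhoP, rho_loss h G hp]
  set V := VaR G fun s => -s
  have hdiff : Integrable (fun u => p * (1 / (2 * k)) * ((V u + A) ^ 2 - (-f u + A) ^ 2)) lam :=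
    (hGmom.2.1.sub hPmom.2.1).const_mul _
  have hzero : ∫ u, p * (1 / (2 * k)) * ((V u + A) ^ 2 - (-f u + A) ^ 2) ∂lam = 0 := by
    rw [integral_const_mul, integral_sub hGmom.2.1 hPmom.2.1, hGmom.2.2, hPmom.2.2, sub_self,
      mul_zero]
  have hPloss := hint_loss _ hPmom.1
  calc ∫ u, (p * max (V u) (-xs) + c * xs) * hD h u ∂lam
      ≤ ∫ u, ((p * max (-f u) (-xs) + c * xs) * hD h u +
          p * (1 / (2 * k)) * ((V u + A) ^ 2 - (-f u + A) ^ 2)) ∂lam := by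
        refine integral_mono_ae (hint_loss V hGmom.1) (hPloss.add hdiff) ?_
        filter_upwards [ae_restrict_mem measurableSet_Ioo] with u hu
        have := mul_le_mul_of_nonneg_left
          (max_mul_le_add_sq_sub_sq hk0 (hw0 u hu) hx (hopt u hu) (V u)) hp.le
        linarith
    _ = ∫ u, (p * max (-f u) (-xs) + c * xs) * hD h u ∂lam := by
        rw [integral_add hPloss hdiff, hzero, add_zero]
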